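/- There exists a positive integer M such that for all m ≥ M, the matrices β₄(σ₃σ₁⁻¹)^m and β₄(σ₂σ₃σ₁⁻¹σ₂⁻¹)^m in GL₃(ℤ[t,t⁻¹]) generate a free group of rank 2. -/

import Mathlib

open Matrix LaurentPolynomial

open scoped Pointwise

/-- Ping-pong for cyclic groups: if all nontrivial powers of `a i` map `X j` into `X i` for `j ≠ i`,
then the `a i` freely generate a free group. -/
theorem FreeGroup.injective_lift_of_zpow_ping_pong {ι G α : Type*} [Nontrivial ι] [Group G]
    [MulAction G α] (a : ι → G) (X : ι → Set α) (hne : ∀ i, (X i).Nonempty)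
    (hdisj : ∀ i j, i ≠ j → Disjoint (X i) (X j))
    (hpp : ∀ i j, i ≠ j → ∀ n : ℤ, n ≠ 0 → ∀ v ∈ X j, a i ^ n • v ∈ X i) :
    Function.Injective (FreeGroup.lift a) := by
  have hlift : FreeGroup.lift a =
      (Monoid.CoprodI.lift fun i => FreeGroup.lift fun _ : Unit => a i).comp
        (freeGroupEquivCoprodI (ι := ι)).toMonoidHom := by
    ext i
    simp
  rw [hlift, MonoidHom.coe_comp]
  refine Function.Injective.comp ?_ (MulEquiv.injective freeGroupEquivCoprodI)
  refine Monoid.CoprodI.lift_injective_of_ping_pong _ ?_ X hne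
    (fun i j hij => hdisj i j hij) ?_
  · obtain ⟨i⟩ : Nonempty ι := inferInstance
    refine Or.inr ⟨i, ?_⟩
    rw [FreeGroup.freeGroupUnitEquivInt.cardinal_eq, Cardinal.mk_denumerable]
    exact Cardinal.natCast_le_aleph0
  · intro i j hij
    refine FreeGroup.freeGroupUnitEquivInt.forall_congr_left.mpr fun n hn => ?_
    change FreeGroup.lift (fun _ => a i) (FreeGroup.of () ^ n) • X j ⊆ X i
    simp only [map_zpow, FreeGroup.lift_apply_of]
    rintro _ ⟨v, hv, rfl⟩
    refine hpp i j hij n ?_ v hv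
    rintro rfl
    exact hn (by simp [FreeGroup.freeGroupUnitEquivInt])

/-- An eigenfunction of `g` is an eigenfunction of every integer power of `g`. -/
theorem zpow_smul_eigenfunction {G α K : Type*} [Group G] [MulAction G α] [Field K] {g : G}
    {φ : α → K} {c : K} (hc : c ≠ 0) (h : ∀ v, φ (g • v) = c * φ v) (n : ℤ) (v : α) :
    φ (g ^ n • v) = c ^ n * φ v := by
  induction n generalizing v with
  | zero => simp
  | succ n ih => rw [_root_.zpow_add_one, mul_smul, ih, h, zpow_add_one₀ hc, mul_assoc]
  | pred n ih =>
    have hinv : φ (g⁻¹ • v) = c⁻¹ * φ v := by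
      rw [← smul_inv_smul g v, h, inv_smul_smul, inv_mul_cancel_left₀ hc]
    rw [_root_.zpow_sub_one, mul_smul, ih, hinv, zpow_sub_one₀ hc, mul_assoc]

namespace BurauPingPong

/-- One of the two outer coordinates dominates the two other coordinates. -/
def Dominated (a b c : ℚ) : Prop :=
  (a ≠ 0 ∧ 100 * |b| ≤ |a| ∧ 100 * |c| ≤ |a|) ∨ (c ≠ 0 ∧ 100 * |b| ≤ |c| ∧ 100 * |a| ≤ |c|)

/-- The two outer coordinates are comparable and control the middle one. -/
def Balanced (a b c : ℚ) : Prop :=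
  a ≠ 0 ∧ c ≠ 0 ∧ |b| ≤ 10 * |a| ∧ |c| ≤ 10 * |a| ∧ |b| ≤ 10 * |c| ∧ |a| ≤ 10 * |c|

theorem Dominated.symm {a b c : ℚ} (h : Dominated a b c) : Dominated c b a :=
  Or.symm h

theorem Balanced.symm {a b c : ℚ} (h : Balanced a b c) : Balanced c b a :=
  ⟨h.2.1, h.1, h.2.2.2.2.1, h.2.2.2.2.2, h.2.2.1, h.2.2.2.1⟩

theorem Balanced.not_dominated {a b c : ℚ} (h : Balanced a b c) : ¬ Dominated a b c := by
  obtain ⟨ha, hc, -, hca, -, hac⟩ := h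
  have ha' := abs_pos.2 ha
  have hc' := abs_pos.2 hc
  rintro (⟨-, -, h⟩ | ⟨-, -, h⟩) <;> linarith

theorem Balanced.dominated_scale {a b c p : ℚ} (h : Balanced a b c) (hp : 1000 ≤ p) :
    Dominated (p * a) b (p⁻¹ * c) := by
  obtain ⟨ha, -, hb, hca, -, -⟩ := h
  have hp0 : 0 < p := by linarith
  have ha' := abs_pos.2 ha
  have hpa : 1000 * |a| ≤ p * |a| := by gcongr
  have hpc : p⁻¹ * |c| ≤ 1 * |c| := by
    gcongr
    exact inv_le_one_of_one_le₀ (by linarith)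
  refine Or.inl ⟨by positivity, ?_, ?_⟩
  · rw [abs_mul, abs_of_pos hp0]
    linarith
  · rw [abs_mul, abs_mul, abs_of_pos hp0, abs_of_pos (inv_pos.2 hp0)]
    linarith

theorem Balanced.dominated_zpow {a b c : ℚ} (h : Balanced a b c) {n : ℤ}
    (hn : 10 ≤ |n|) : Dominated (2 ^ n * a) b ((2⁻¹) ^ n * c) := by
  have key : ∀ k : ℤ, 10 ≤ k → (1000 : ℚ) ≤ 2 ^ k := fun k hk =>
    calc (1000 : ℚ) ≤ 2 ^ (10 : ℤ) := by norm_num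
      _ ≤ 2 ^ k := zpow_le_zpow_right₀ (by norm_num) hk
  rcases le_abs'.1 hn with hn | hn
  · have := (h.symm.dominated_scale (key (-n) (by linarith))).symm
    simpa [_root_.inv_zpow] using this
  · simpa [_root_.inv_zpow] using h.dominated_scale (key n hn)

/-- The ping-pong set: vectors which, in the eigenbasis of the specialized matrix of `σ₃σ₁⁻¹`,
are dominated by the coordinate of the largest or of the smallest eigenvalue. -/
def eigenCone : Set (Fin 3 → ℚ) :=
  {v | Dominated (v 2 - 2 * v 1) (v 1) (v 0 + v 1)}

/-- Vectors with balanced coordinates in the eigenbasis of the specialized `σ₃σ₁⁻¹`. -/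
def balancedCone : Set (Fin 3 → ℚ) :=
  {v | Balanced (v 2 - 2 * v 1) (v 1) (v 0 + v 1)}

/-- The specialization at `t = -2` of the reduced Burau matrix of `σ₃σ₁⁻¹`. -/
def matX : Matrix (Fin 3) (Fin 3) ℚ := !![1/2, -1/2, 0; 0, 1, 0; 0, -2, 2]

/-- The specialization at `t = -2` of the reduced Burau matrix of `σ₂`. -/
def matS : Matrix (Fin 3) (Fin 3) ℚ := !![1, 0, 0; -2, 2, 1; 0, 0, 1]

theorem zpow_smul_mem_eigenCone {g : GL (Fin 3) ℚ} (hg : g.val = matX) {n : ℤ} (hn : 10 ≤ |n|)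
    {v : Fin 3 → ℚ} (hv : v ∈ balancedCone) : g ^ n • v ∈ eigenCone := by
  have hsmul : ∀ w : Fin 3 → ℚ, g • w = matX *ᵥ w := fun w => by
    rw [Units.smul_def, hg, smul_eq_mulVec]
  have ha := zpow_smul_eigenfunction (g := g) (φ := fun w : Fin 3 → ℚ => w 2 - 2 * w 1) (c := 2)
    (by norm_num) (fun w => by
      simp [hsmul, matX, Matrix.mulVec, dotProduct, Fin.sum_univ_three]; ring) n v
  have hb := zpow_smul_eigenfunction (g := g) (φ := fun w : Fin 3 → ℚ => w 1) (c := 1)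
    (by norm_num) (fun w => by
      simp [hsmul, matX, Matrix.mulVec, dotProduct, Fin.sum_univ_three]) n v
  have hc := zpow_smul_eigenfunction (g := g) (φ := fun w : Fin 3 → ℚ => w 0 + w 1) (c := 2⁻¹)
    (by norm_num) (fun w => by
      simp [hsmul, matX, Matrix.mulVec, dotProduct, Fin.sum_univ_three]; ring) n v
  have h := Balanced.dominated_zpow hv hn
  rw [_root_.one_zpow, one_mul] at hb
  rw [← ha, ← hc, ← hb] at h
  exact h

theorem dominated_abs_cases {a b c : ℚ} (h : Dominated a b c) :
    ∃ r : ℚ, 0 < r ∧ -r ≤ 100 * b ∧ 100 * b ≤ r ∧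
      (((a = r ∨ a = -r) ∧ -r ≤ 100 * c ∧ 100 * c ≤ r) ∨
        ((c = r ∨ c = -r) ∧ -r ≤ 100 * a ∧ 100 * a ≤ r)) := by
  have aux : ∀ {s r : ℚ}, 100 * |s| ≤ r → -r ≤ 100 * s ∧ 100 * s ≤ r := fun {s r} hs => by
    constructor <;> linarith [neg_abs_le s, le_abs_self s]
  rcases h with ⟨ha, hb, hc⟩ | ⟨hc, hb, ha⟩
  · exact ⟨|a|, abs_pos.2 ha, (aux hb).1, (aux hb).2,
      Or.inl ⟨eq_or_eq_neg_of_abs_eq rfl, aux hc⟩⟩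
  · exact ⟨|c|, abs_pos.2 hc, (aux hb).1, (aux hb).2,
      Or.inr ⟨eq_or_eq_neg_of_abs_eq rfl, aux ha⟩⟩

theorem balanced_of_bounds {a b c r : ℚ} (hr : 0 < r) (ha : 21/50 * r ≤ |a|)
    (hc : 21/50 * r ≤ |c|) (ha' : |a| ≤ 21/5 * r) (hb' : |b| ≤ 21/5 * r)
    (hc' : |c| ≤ 21/5 * r) : Balanced a b c :=
  ⟨abs_pos.1 (by linarith), abs_pos.1 (by linarith), by linarith, by linarith, by linarith,
    by linarith⟩

/-- The change of eigencoordinates given by `matS` sends dominated vectors to balanced ones. -/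
theorem balanced_of_dominated {a b c : ℚ} (h : Dominated a b c) :
    Balanced (-a - 10 * b + 4 * c) (a + 6 * b - 2 * c) (a + 5 * b - c) := by
  obtain ⟨r, hr, hb, hb', ⟨rfl | rfl, h₁, h₂⟩ | ⟨rfl | rfl, h₁, h₂⟩⟩ := dominated_abs_cases h <;>
  refine balanced_of_bounds hr (le_abs'.2 ?_) (le_abs'.2 ?_) (abs_le.2 ⟨?_, ?_⟩)
    (abs_le.2 ⟨?_, ?_⟩) (abs_le.2 ⟨?_, ?_⟩) <;>
  first | linarith | exact Or.inl (by linarith) | exact Or.inr (by linarith)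

/-- The change of eigencoordinates given by the inverse of `matS` sends dominated vectors to
balanced ones. -/
theorem balanced_of_dominated_inv {a b c : ℚ} (h : Dominated a b c) :
    Balanced (2 * a + 5 * b - 2 * c) (-a / 2 - 3 / 2 * b + c) (-a / 2 - 5 / 2 * b + 2 * c) := by
  obtain ⟨r, hr, hb, hb', ⟨rfl | rfl, h₁, h₂⟩ | ⟨rfl | rfl, h₁, h₂⟩⟩ := dominated_abs_cases h <;>
  refine balanced_of_bounds hr (le_abs'.2 ?_) (le_abs'.2 ?_) (abs_le.2 ⟨?_, ?_⟩)
    (abs_le.2 ⟨?_, ?_⟩) (abs_le.2 ⟨?_, ?_⟩) <;>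
  first | linarith | exact Or.inl (by linarith) | exact Or.inr (by linarith)

theorem matS_smul {s : GL (Fin 3) ℚ} (hs : s.val = matS) (v : Fin 3 → ℚ) :
    s • v = ![v 0, -2 * v 0 + 2 * v 1 + v 2, v 2] := by
  rw [Units.smul_def, hs, smul_eq_mulVec]
  ext i
  fin_cases i <;> simp [matS, Matrix.mulVec, dotProduct, Fin.sum_univ_three]

theorem smul_mem_balancedCone {s : GL (Fin 3) ℚ} (hs : s.val = matS) {v : Fin 3 → ℚ}
    (hv : v ∈ eigenCone) : s • v ∈ balancedCone := by
  have h := balanced_of_dominated hv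
  simp only [balancedCone, Set.mem_ofPred_eq, matS_smul hs]
  convert h using 1 <;> simp <;> ring

theorem inv_smul_mem_balancedCone {s : GL (Fin 3) ℚ} (hs : s.val = matS) {v : Fin 3 → ℚ}
    (hv : v ∈ eigenCone) : s⁻¹ • v ∈ balancedCone := by
  obtain ⟨w, rfl⟩ := MulAction.surjective s v
  rw [inv_smul_smul]
  simp only [eigenCone, Set.mem_ofPred_eq, matS_smul hs] at hv
  have h := balanced_of_dominated_inv hv
  simp only [balancedCone, Set.mem_ofPred_eq]
  convert h using 1 <;> simp <;> ring

/-- At `t = -2`, large powers of `σ₃σ₁⁻¹` and of its conjugate by `σ₂` are free generators. -/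
theorem injective_lift_pow {g s : GL (Fin 3) ℚ} (hg : g.val = matX) (hs : s.val = matS) {m : ℕ}
    (hm : 10 ≤ m) : Function.Injective (FreeGroup.lift ![g ^ m, (s * g * s⁻¹) ^ m]) := by
  have hpow : ∀ n : ℤ, n ≠ 0 → 10 ≤ |(m : ℤ) * n| := fun n hn => by
    rw [abs_mul, Nat.abs_cast]
    have := Int.one_le_abs hn
    nlinarith
  have hbal : ∀ v ∈ balancedCone, v ∉ eigenCone := fun v hv => Balanced.not_dominated hv
  have hne : ![0, 0, 1] ∈ eigenCone := by
    simp [eigenCone, Dominated]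
  refine FreeGroup.injective_lift_of_zpow_ping_pong _ ![eigenCone, {v | s⁻¹ • v ∈ eigenCone}]
    ?_ ?_ ?_
  · intro i
    fin_cases i
    · exact ⟨_, hne⟩
    · exact ⟨s • ![0, 0, 1], by simpa using hne⟩
  · intro i j hij
    fin_cases i <;> fin_cases j <;> first | exact absurd rfl hij | skip
    · exact Set.disjoint_left.2 fun v hv hv' => hbal _ (inv_smul_mem_balancedCone hs hv) hv'
    · exact Set.disjoint_left.2 fun v hv hv' => hbal _ (inv_smul_mem_balancedCone hs hv') hv
  · intro i j hij n hn v hv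
    fin_cases i <;> fin_cases j <;> first | exact absurd rfl hij | skip
    · change (g ^ m) ^ n • v ∈ eigenCone
      rw [← zpow_natCast, ← _root_.zpow_mul]
      refine zpow_smul_mem_eigenCone hg (hpow n hn) ?_
      simpa using smul_mem_balancedCone hs (v := s⁻¹ • v) hv
    · change s⁻¹ • ((s * g * s⁻¹) ^ m) ^ n • v ∈ eigenCone
      rw [← zpow_natCast, ← _root_.zpow_mul, conj_zpow, mul_smul, mul_smul, inv_smul_smul]
      exact zpow_smul_mem_eigenCone hg (hpow n hn) (inv_smul_mem_balancedCone hs hv)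

/-- The specialization `t ↦ -2`. -/
noncomputable def specialize : LaurentPolynomial ℤ →+* ℚ :=
  LaurentPolynomial.eval₂ (Int.castRingHom ℚ) (Units.mk0 (-2) (by norm_num))

theorem specialize_T_one : specialize (LaurentPolynomial.T 1) = -2 := by
  simp [specialize, LaurentPolynomial.eval₂_T]

end BurauPingPong

/-- There is a positive integer `M` such that for all `m ≥ M`, the
matrices `β₄(σ₃σ₁⁻¹)^m` and `β₄(σ₂σ₃σ₁⁻¹σ₂⁻¹)^m` in `GL₃(ℤ[t,t⁻¹])` generate a free
group of rank 2. -/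
theorem powers_generate_free_group
    (B1 B2 B3 : Matrix (Fin 3) (Fin 3) (LaurentPolynomial ℤ))
    (hB1 : B1 = !![-(LaurentPolynomial.T 1), 1, 0; 0, 1, 0; 0, 0, 1])
    (hB2 : B2 = !![1, 0, 0; LaurentPolynomial.T 1, -(LaurentPolynomial.T 1), 1; 0, 0, 1])
    (hB3 : B3 = !![1, 0, 0; 0, 1, 0; 0, LaurentPolynomial.T 1, -(LaurentPolynomial.T 1)]) :
    ∃ M : ℕ, 0 < M ∧ ∀ m, M ≤ m →
      ∀ x y : Matrix.GeneralLinearGroup (Fin 3) (LaurentPolynomial ℤ),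
        (x : Matrix (Fin 3) (Fin 3) (LaurentPolynomial ℤ)) = B3 * B1⁻¹ →
        (y : Matrix (Fin 3) (Fin 3) (LaurentPolynomial ℤ)) = B2 * B3 * B1⁻¹ * B2⁻¹ →
        Nonempty
          ((Subgroup.closure {x ^ m, y ^ m} :
            Subgroup (Matrix.GeneralLinearGroup (Fin 3) (LaurentPolynomial ℤ)))
            ≃* FreeGroup (Fin 2)) := by
  refine ⟨10, by norm_num, fun m hm x y hx hy => ?_⟩
  have hT : IsUnit (LaurentPolynomial.T 1 : LaurentPolynomial ℤ) := LaurentPolynomial.isUnit_T 1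
  have hB1u : IsUnit B1.det := by simpa [hB1, Matrix.det_fin_three] using hT
  have hB2u : IsUnit B2.det := by simpa [hB2, Matrix.det_fin_three] using hT
  have hxB : x.val * B1 = B3 := by
    rw [hx, Matrix.mul_assoc, Matrix.nonsing_inv_mul _ hB1u, Matrix.mul_one]
  obtain ⟨s, hs⟩ : ∃ s : GL (Fin 3) (LaurentPolynomial ℤ), s.val = B2 :=
    (Matrix.isUnit_iff_isUnit_det B2).2 hB2u
  have hys : y = s * x * s⁻¹ := by
    rw [eq_mul_inv_iff_mul_eq]
    ext1
    rw [Units.val_mul, Units.val_mul, hs, hx, hy, Matrix.mul_assoc _ B2⁻¹,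
      Matrix.nonsing_inv_mul _ hB2u, Matrix.mul_one, Matrix.mul_assoc]
  let ρ := Matrix.GeneralLinearGroup.map (n := Fin 3) BurauPingPong.specialize
  have hρs : (ρ s).val = BurauPingPong.matS := by
    change s.val.map BurauPingPong.specialize = _
    rw [hs, hB2]
    ext i j
    fin_cases i <;> fin_cases j <;>
      simp [BurauPingPong.matS, BurauPingPong.specialize_T_one]
  have hρx : (ρ x).val = BurauPingPong.matX := by
    change x.val.map BurauPingPong.specialize = _
    have h := congrArg (fun A => A.map BurauPingPong.specialize) hxB
    simp only [Matrix.map_mul] at h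
    have hinv : B1.map BurauPingPong.specialize *
        !![1/2, -1/2, 0; 0, 1, 0; 0, 0, 1] = 1 := by
      rw [hB1]
      ext i j
      fin_cases i <;> fin_cases j <;>
        simp [Matrix.mul_apply, Fin.sum_univ_three, BurauPingPong.specialize_T_one]
      norm_num
    rw [← Matrix.mul_one (x.val.map _), ← hinv, ← Matrix.mul_assoc, h, hB3]
    ext i j
    fin_cases i <;> fin_cases j <;>
      simp [Matrix.mul_apply, Fin.sum_univ_three, BurauPingPong.matX,
        BurauPingPong.specialize_T_one]
  have hcomp : ρ.comp (FreeGroup.lift ![x ^ m, y ^ m]) =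
      FreeGroup.lift ![ρ x ^ m, (ρ s * ρ x * (ρ s)⁻¹) ^ m] := by
    ext1 i
    fin_cases i <;> simp [hys]
  have hinj : Function.Injective (FreeGroup.lift ![x ^ m, y ^ m]) := by
    have h := BurauPingPong.injective_lift_pow hρx hρs hm
    rw [← hcomp, MonoidHom.coe_comp] at h
    exact h.of_comp
  have hrange : (FreeGroup.lift ![x ^ m, y ^ m]).range = Subgroup.closure {x ^ m, y ^ m} := by
    rw [FreeGroup.range_lift_eq_closure, Matrix.range_cons, Matrix.range_cons,
      Matrix.range_empty, Set.union_empty, Set.singleton_union]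
  exact ⟨((MonoidHom.ofInjective hinj).trans (MulEquiv.subgroupCongr hrange)).symm⟩
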